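/- arXiv:1904.08291 — 5 statements merged into one kernel-verified Lean document; each statement's English description precedes it below -/
import Mathlib

section
/- For every r ∈ [0,1] one has (γ₁/b₀) r(log r − 1) ≤ η(r) ≤ (γ/‖b‖_∞) r(log r − 1), and for every r ≥ 1 one has (γ/‖b‖_∞) r(log r − 1) + γ/‖b‖_∞ − γ₁/b₀ ≤ η(r) ≤ (γ₁/b₀) r(log r − 1) + γ₁/b₀ − γ/‖b‖_∞ (with the convention 0·log 0 = 0). -/
open MeasureTheory Real Set Filter
open scoped ENNReal NNReal Topology RealInnerProductSpace

noncomputable section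

abbrev Euc (d : ℕ) : Type := EuclideanSpace ℝ (Fin d)

def IsTest {d : ℕ} (φ : Euc d → ℝ) : Prop :=
  ContDiff ℝ (⊤ : ℕ∞) φ ∧ HasCompactSupport φ

def lapl {d : ℕ} (φ : Euc d → ℝ) (x : Euc d) : ℝ :=
  ∑ i : Fin d, fderiv ℝ (fun y => fderiv ℝ φ y (EuclideanSpace.single i 1)) x
    (EuclideanSpace.single i 1)

def HasWeakGrad {d : ℕ} (u : Euc d → ℝ) (G : Euc d → Euc d) : Prop :=
  ∀ φ : Euc d → ℝ, IsTest φ → ∫ x, u x • gradient φ x = - ∫ x, φ x • G x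

def HasWeakDiv {d : ℕ} (D : Euc d → Euc d) (g : Euc d → ℝ) : Prop :=
  ∀ φ : Euc d → ℝ, IsTest φ → (∫ x, ⟪D x, gradient φ x⟫) = - ∫ x, g x * φ x

def HasWeakLapl {d : ℕ} (Φ : Euc d → ℝ) (L : Euc d → ℝ) : Prop :=
  ∀ φ : Euc d → ℝ, IsTest φ → ∫ x, Φ x * lapl φ x = ∫ x, L x * φ x

/-- The entropy kernel `η(r) = −∫₀^r ∫_τ^1 β′(s)/(s b(s)) ds dτ`. -/
def eta (β b : ℝ → ℝ) (r : ℝ) : ℝ :=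
  - ∫ τ in (0:ℝ)..r, (∫ s in τ..(1:ℝ), deriv β s / (s * b s))

/-- A function on `(0, ∞)` trapped between `c / s` and `C / s` has integrals trapped between
the corresponding multiples of the logarithm increments. -/
lemma integral_mem_Icc_of_div_bounds {F : ℝ → ℝ} {c C : ℝ} (hF : ContinuousOn F (Ioi 0))
    (hbd : ∀ s, 0 < s → c / s ≤ F s ∧ F s ≤ C / s) {x y : ℝ} (hx : 0 < x) (hxy : x ≤ y) :
    c * (Real.log y - Real.log x) ≤ ∫ s in x..y, F s ∧
      ∫ s in x..y, F s ≤ C * (Real.log y - Real.log x) := by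
  have hpos : ∀ s ∈ Icc x y, 0 < s := fun s hs => hx.trans_le hs.1
  have hFi : IntervalIntegrable F volume x y :=
    ContinuousOn.intervalIntegrable_of_Icc hxy (hF.mono hpos)
  have hdi : ∀ k : ℝ, IntervalIntegrable (fun s => k / s) volume x y := fun k =>
    ContinuousOn.intervalIntegrable_of_Icc hxy
      (continuousOn_const.div continuousOn_id fun s hs => (hpos s hs).ne')
  have hval : ∀ k : ℝ, ∫ s in x..y, k / s = k * (Real.log y - Real.log x) := fun k => by
    simp_rw [div_eq_mul_inv]
    rw [intervalIntegral.integral_const_mul, integral_inv_of_pos hx (hx.trans_le hxy),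
      Real.log_div (hx.trans_le hxy).ne' hx.ne']
  rw [← hval c, ← hval C]
  exact ⟨intervalIntegral.integral_mono_on hxy (hdi c) hFi fun s hs => (hbd s (hpos s hs)).1,
    intervalIntegral.integral_mono_on hxy hFi (hdi C) fun s hs => (hbd s (hpos s hs)).2⟩

lemma continuousOn_integral_left {F : ℝ → ℝ} (hF : ContinuousOn F (Ioi 0)) :
    ContinuousOn (fun τ => ∫ s in τ..(1:ℝ), F s) (Ioi 0) := by
  intro τ hτ
  have hint : IntervalIntegrable F volume τ 1 :=
    (hF.mono fun s hs => (lt_min hτ one_pos).trans_le hs.1).intervalIntegrable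
  exact (intervalIntegral.integral_hasDerivAt_left hint
    (hF.stronglyMeasurableAtFilter isOpen_Ioi τ hτ)
    (hF.continuousAt (Ioi_mem_nhds hτ))).continuousAt.continuousWithinAt

lemma intervalIntegrable_integral_left {F : ℝ → ℝ} {c C : ℝ} (hc : 0 ≤ c)
    (hF : ContinuousOn F (Ioi 0)) (hbd : ∀ s, 0 < s → c / s ≤ F s ∧ F s ≤ C / s)
    {r : ℝ} (hr : 0 ≤ r) :
    IntervalIntegrable (fun τ => ∫ s in τ..(1:ℝ), F s) volume 0 r := by
  have hlog : IntervalIntegrable (fun τ => C * Real.log τ) volume 0 r :=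
    intervalIntegral.intervalIntegrable_log'.const_mul C
  refine hlog.mono_fun ?_ ?_
  · rw [uIoc_of_le hr]
    exact ((continuousOn_integral_left hF).mono fun s hs => hs.1).aestronglyMeasurable
      measurableSet_Ioc
  · rw [uIoc_of_le hr]
    refine (ae_restrict_mem measurableSet_Ioc).mono fun τ hτ => ?_
    simp only [Real.norm_eq_abs]
    rcases le_total τ 1 with h | h
    · obtain ⟨h₁, h₂⟩ := integral_mem_Icc_of_div_bounds hF hbd hτ.1 h
      have hl := Real.log_nonpos hτ.1.le h
      rw [Real.log_one, zero_sub] at h₁ h₂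
      have h₀ := (mul_nonneg hc (neg_nonneg.2 hl)).trans h₁
      rw [abs_of_nonneg h₀, ← abs_neg, ← mul_neg]
      exact h₂.trans (le_abs_self _)
    · obtain ⟨h₁, h₂⟩ := integral_mem_Icc_of_div_bounds hF hbd one_pos h
      have hl := Real.log_nonneg h
      rw [Real.log_one, sub_zero] at h₁ h₂
      have h₀ := (mul_nonneg hc hl).trans h₁
      rw [intervalIntegral.integral_symm, abs_neg, abs_of_nonneg h₀]
      exact h₂.trans (le_abs_self _)

/-- Bounds on `[0, 1]` for the iterated integral of a function trapped between `c / s` and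
`C / s`. -/
lemma integral_integral_bounds_of_le_one {F : ℝ → ℝ} {c C : ℝ} (hc : 0 ≤ c)
    (hF : ContinuousOn F (Ioi 0)) (hbd : ∀ s, 0 < s → c / s ≤ F s ∧ F s ≤ C / s)
    {r : ℝ} (hr : 0 ≤ r) (hr1 : r ≤ 1) :
    C * (r * (Real.log r - 1)) ≤ -∫ τ in (0:ℝ)..r, ∫ s in τ..(1:ℝ), F s ∧
      -∫ τ in (0:ℝ)..r, ∫ s in τ..(1:ℝ), F s ≤ c * (r * (Real.log r - 1)) := by
  have hI := intervalIntegrable_integral_left hc hF hbd hr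
  have hlog : ∀ k : ℝ, IntervalIntegrable (fun τ => k * -Real.log τ) volume 0 r := fun k =>
    intervalIntegral.intervalIntegrable_log'.neg.const_mul k
  have hval : ∀ k : ℝ, ∫ τ in (0:ℝ)..r, k * -Real.log τ = -(k * (r * (Real.log r - 1))) :=
    fun k => by
      rw [intervalIntegral.integral_const_mul, intervalIntegral.integral_neg, integral_log]
      ring
  have hb : ∀ τ ∈ Ioo 0 r, c * -Real.log τ ≤ ∫ s in τ..(1:ℝ), F s ∧
      ∫ s in τ..(1:ℝ), F s ≤ C * -Real.log τ := fun τ hτ => by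
    simpa using integral_mem_Icc_of_div_bounds hF hbd hτ.1 (hτ.2.le.trans hr1)
  have h₁ := intervalIntegral.integral_mono_on_of_le_Ioo hr (hlog c) hI fun τ hτ => (hb τ hτ).1
  have h₂ := intervalIntegral.integral_mono_on_of_le_Ioo hr hI (hlog C) fun τ hτ => (hb τ hτ).2
  rw [hval] at h₁ h₂
  constructor <;> linarith

/-- Bounds on `[1, ∞)` for the iterated integral of a function trapped between `c / s` and
`C / s`. -/
lemma integral_integral_bounds_of_one_le {F : ℝ → ℝ} {c C : ℝ} (hc : 0 ≤ c)
    (hF : ContinuousOn F (Ioi 0)) (hbd : ∀ s, 0 < s → c / s ≤ F s ∧ F s ≤ C / s)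
    {r : ℝ} (hr : 1 ≤ r) :
    c * (r * (Real.log r - 1)) + c - C ≤ -∫ τ in (0:ℝ)..r, ∫ s in τ..(1:ℝ), F s ∧
      -∫ τ in (0:ℝ)..r, ∫ s in τ..(1:ℝ), F s ≤ C * (r * (Real.log r - 1)) + C - c := by
  have hI₀ := intervalIntegrable_integral_left hc hF hbd zero_le_one
  have hI : IntervalIntegrable (fun τ => ∫ s in τ..(1:ℝ), F s) volume 1 r :=
    hI₀.symm.trans (intervalIntegrable_integral_left hc hF hbd (zero_le_one.trans hr))
  have hlog : ∀ k : ℝ, IntervalIntegrable (fun τ => k * -Real.log τ) volume 1 r := fun k =>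
    intervalIntegral.intervalIntegrable_log'.neg.const_mul k
  have hval : ∀ k : ℝ, ∫ τ in (1:ℝ)..r, k * -Real.log τ =
      -(k * (r * (Real.log r - 1)) + k) := fun k => by
    rw [intervalIntegral.integral_const_mul, intervalIntegral.integral_neg, integral_log,
      Real.log_one]
    ring
  have hb : ∀ τ ∈ Icc 1 r, C * -Real.log τ ≤ ∫ s in τ..(1:ℝ), F s ∧
      ∫ s in τ..(1:ℝ), F s ≤ c * -Real.log τ := fun τ hτ => by
    obtain ⟨h₁, h₂⟩ := integral_mem_Icc_of_div_bounds hF hbd one_pos hτ.1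
    rw [Real.log_one, sub_zero] at h₁ h₂
    rw [intervalIntegral.integral_symm]
    constructor <;> linarith
  have h₁ := intervalIntegral.integral_mono_on hr (hlog C) hI fun τ hτ => (hb τ hτ).1
  have h₂ := intervalIntegral.integral_mono_on hr hI (hlog c) fun τ hτ => (hb τ hτ).2
  obtain ⟨h₃, h₄⟩ := integral_integral_bounds_of_le_one hc hF hbd zero_le_one le_rfl
  rw [hval] at h₁ h₂
  rw [Real.log_one] at h₃ h₄
  rw [← intervalIntegral.integral_add_adjacent_intervals hI₀ hI]
  constructor <;> linarith

/-- two-sided Boltzmann-type bounds for the entropy kernel `η`. -/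
theorem stmt5
    (γ γ₁ : ℝ) (hγ : 0 < γ) (hγγ₁ : γ < γ₁)
    (β : ℝ → ℝ) (hβ : ContDiff ℝ 1 β) (hβ0 : β 0 = 0)
    (hβ' : ∀ r : ℝ, γ ≤ deriv β r ∧ deriv β r ≤ γ₁)
    (b : ℝ → ℝ) (hb : ContDiff ℝ 1 b) (hbbd : ∃ M : ℝ, ∀ r : ℝ, |b r| ≤ M)
    (b₀ : ℝ) (hb₀ : 0 < b₀) (hbb₀ : ∀ r : ℝ, 0 ≤ r → b₀ ≤ b r) :
    (∀ r ∈ Icc (0:ℝ) 1,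
      γ₁ / b₀ * (r * (Real.log r - 1)) ≤ eta β b r
      ∧ eta β b r ≤ γ / (⨆ s : ℝ, |b s|) * (r * (Real.log r - 1)))
    ∧ (∀ r : ℝ, 1 ≤ r →
      γ / (⨆ s : ℝ, |b s|) * (r * (Real.log r - 1))
          + γ / (⨆ s : ℝ, |b s|) - γ₁ / b₀ ≤ eta β b r
      ∧ eta β b r ≤ γ₁ / b₀ * (r * (Real.log r - 1))
          + γ₁ / b₀ - γ / (⨆ s : ℝ, |b s|)) := by
  have hbB : ∀ s, |b s| ≤ ⨆ s : ℝ, |b s| := le_ciSup (by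
    obtain ⟨M, hM⟩ := hbbd
    exact ⟨M, by rintro _ ⟨s, rfl⟩; exact hM s⟩)
  have hB : 0 < ⨆ s : ℝ, |b s| :=
    hb₀.trans_le ((hbb₀ 0 le_rfl).trans ((le_abs_self _).trans (hbB 0)))
  have hbpos : ∀ s, 0 < s → 0 < b s := fun s hs => hb₀.trans_le (hbb₀ s hs.le)
  have hF : ContinuousOn (fun s => deriv β s / (s * b s)) (Ioi 0) :=
    (hβ.continuous_deriv le_rfl).continuousOn.div
      (continuousOn_id.mul hb.continuous.continuousOn)
      fun s hs => (mul_pos hs (hbpos s hs)).ne'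
  have hbd : ∀ s, 0 < s → γ / (⨆ s : ℝ, |b s|) / s ≤ deriv β s / (s * b s) ∧
      deriv β s / (s * b s) ≤ γ₁ / b₀ / s := fun s hs => by
    rw [mul_comm s, ← div_div]
    constructor
    · gcongr
      · exact hγ.le.trans (hβ' s).1
      · exact hbpos s hs
      · exact (hβ' s).1
      · exact (le_abs_self _).trans (hbB s)
    · gcongr
      · exact (hγ.trans hγγ₁).le
      · exact (hβ' s).2
      · exact hbb₀ s hs.le
  have hc : 0 ≤ γ / (⨆ s : ℝ, |b s|) := (div_pos hγ hB).le
  exact ⟨fun r hr => integral_integral_bounds_of_le_one hc hF hbd hr.1 hr.2,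
    fun r hr => integral_integral_bounds_of_one_le hc hF hbd hr⟩
end
end

section
/- For every α ∈ [m/(m+1), 1) there exists a constant C ∈ (0,∞) such that for every u ∈ L¹(ℝ^d) with u ≥ 0 a.e. and ‖u‖ := ∫ Φ u dx < ∞, one has V(u) ≥ −C(‖u‖ + 1)^α, where V(u) := ∫ η(u) dx + ∫ Φ u dx (the integral ∫ η(u) dx being well defined in (−∞,∞] since the negative part of η(u) is integrable). -/
open MeasureTheory Real Set Filter
open scoped ENNReal NNReal Topology RealInnerProductSpace

noncomputable section

/-- Monotonicity of the interval integral against a nonnegative integrable majorant; no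
integrability of the smaller function is needed. -/
lemma intervalIntegral_le_of_le_of_nonneg {f h : ℝ → ℝ} {a c : ℝ} (hac : a ≤ c)
    (hh : IntervalIntegrable h volume a c) (h0 : ∀ x ∈ Ioc a c, 0 ≤ h x)
    (hfh : ∀ x ∈ Ioc a c, f x ≤ h x) :
    ∫ x in a..c, f x ≤ ∫ x in a..c, h x := by
  rw [intervalIntegral.integral_of_le hac, intervalIntegral.integral_of_le hac]
  by_cases hf : IntegrableOn f (Ioc a c)
  · exact setIntegral_mono_on hf hh.1 measurableSet_Ioc hfh
  · rw [integral_undef hf]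
    exact setIntegral_nonneg measurableSet_Ioc h0

lemma measurable_intervalIntegral {f : ℝ → ℝ} (hf : Measurable f) :
    Measurable (fun p : ℝ × ℝ => ∫ s in p.1..p.2, f s) := by
  have key : Measurable (fun p : ℝ × ℝ => ∫ s in Ioc p.1 p.2, f s) := by
    have hS : MeasurableSet {q : (ℝ × ℝ) × ℝ | q.1.1 < q.2 ∧ q.2 ≤ q.1.2} :=
      (measurableSet_lt measurable_fst.fst measurable_snd).inter
        (measurableSet_le measurable_snd measurable_fst.snd)
    have hF : Measurable ({q : (ℝ × ℝ) × ℝ | q.1.1 < q.2 ∧ q.2 ≤ q.1.2}.indicator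
        (fun q => f q.2)) := (hf.comp measurable_snd).indicator hS
    have := (hF.stronglyMeasurable.integral_prod_right' (ν := (volume : Measure ℝ))).measurable
    convert this using 2 with p
    exact (integral_indicator measurableSet_Ioc).symm
  simp only [intervalIntegral]
  exact key.sub (key.comp measurable_swap)

lemma measurable_eta {β b : ℝ → ℝ} (hb : Measurable b) : Measurable (eta β b) := by
  have hf : Measurable (fun s : ℝ => deriv β s / (s * b s)) :=
    (measurable_deriv β).div (measurable_id.mul hb)
  have hg : Measurable (fun τ : ℝ => ∫ s in τ..(1:ℝ), deriv β s / (s * b s)) :=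
    (measurable_intervalIntegral hf).comp (measurable_id.prodMk measurable_const)
  exact ((measurable_intervalIntegral hg).comp (measurable_const.prodMk measurable_id)).neg

/-- The inner integral of the entropy kernel has at most a logarithmic singularity at `0`, hence
is bounded by any negative power. -/
lemma integral_deriv_div_le {β b : ℝ → ℝ} {γ₁ b₀ α τ : ℝ}
    (hβ0 : ∀ r, 0 ≤ deriv β r) (hβ1 : ∀ r, deriv β r ≤ γ₁)
    (hb₀ : 0 < b₀) (hbb₀ : ∀ r, 0 ≤ r → b₀ ≤ b r) (hα : α < 1) (hτ : 0 < τ) :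
    ∫ s in τ..(1:ℝ), deriv β s / (s * b s) ≤ γ₁ / b₀ / (1 - α) * τ ^ (α - 1) := by
  have hγ₁ : 0 ≤ γ₁ := (hβ0 0).trans (hβ1 0)
  have hα' : 0 < 1 - α := by linarith
  rcases le_total τ 1 with h1 | h1
  · calc ∫ s in τ..(1:ℝ), deriv β s / (s * b s)
        ≤ ∫ s in τ..(1:ℝ), γ₁ / b₀ * s⁻¹ := by
          refine intervalIntegral_le_of_le_of_nonneg h1 ?_ ?_ ?_
          · refine IntervalIntegrable.const_mul ?_ _
            refine intervalIntegral.intervalIntegrable_inv ?_ continuousOn_id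
            intro x hx
            rw [uIcc_of_le h1] at hx
            exact (hτ.trans_le hx.1).ne'
          · intro s hs
            have : 0 < s := hτ.trans hs.1
            positivity
          · intro s hs
            have hs0 : 0 < s := hτ.trans hs.1
            have hbs := hbb₀ s hs0.le
            rw [← div_eq_mul_inv, div_div, mul_comm b₀ s]
            gcongr
            exact hβ1 s
      _ = γ₁ / b₀ * Real.log τ⁻¹ := by
          rw [intervalIntegral.integral_const_mul, integral_inv_of_pos hτ one_pos, one_div]
      _ ≤ γ₁ / b₀ * ((τ⁻¹) ^ (1 - α) / (1 - α)) := by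
          gcongr
          exact Real.log_le_rpow_div (by positivity) hα'
      _ = γ₁ / b₀ / (1 - α) * τ ^ (α - 1) := by
          rw [Real.inv_rpow hτ.le, ← Real.rpow_neg hτ.le, neg_sub]
          ring
  · have h0 : 0 ≤ ∫ s in (1:ℝ)..τ, deriv β s / (s * b s) := by
      refine intervalIntegral.integral_nonneg h1 fun s hs => ?_
      have hs0 : 0 < s := one_pos.trans_le hs.1
      exact div_nonneg (hβ0 s) (mul_nonneg hs0.le (hb₀.le.trans (hbb₀ s hs0.le)))
    rw [intervalIntegral.integral_symm]
    exact (neg_nonpos.2 h0).trans (by positivity)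

lemma neg_rpow_le_eta {β b : ℝ → ℝ} {γ₁ b₀ α r : ℝ}
    (hβ0 : ∀ r, 0 ≤ deriv β r) (hβ1 : ∀ r, deriv β r ≤ γ₁)
    (hb₀ : 0 < b₀) (hbb₀ : ∀ r, 0 ≤ r → b₀ ≤ b r) (hα0 : 0 < α) (hα : α < 1) (hr : 0 ≤ r) :
    -(γ₁ / b₀ / (1 - α) / α * r ^ α) ≤ eta β b r := by
  have hγ₁ : 0 ≤ γ₁ := (hβ0 0).trans (hβ1 0)
  have hα' : 0 < 1 - α := by linarith
  refine neg_le_neg ?_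
  calc _ ≤ ∫ τ in (0:ℝ)..r, γ₁ / b₀ / (1 - α) * τ ^ (α - 1) := by
        refine intervalIntegral_le_of_le_of_nonneg hr ?_ ?_ ?_
        · exact (intervalIntegral.intervalIntegrable_rpow' (by linarith)).const_mul _
        · intro τ hτ
          have : 0 < τ := hτ.1
          positivity
        · intro τ hτ
          exact integral_deriv_div_le hβ0 hβ1 hb₀ hbb₀ hα hτ.1
    _ = γ₁ / b₀ / (1 - α) / α * r ^ α := by
        rw [intervalIntegral.integral_const_mul, integral_rpow (Or.inl (by linarith)),
          sub_add_cancel, Real.zero_rpow hα0.ne', sub_zero]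
        ring

/-- A pointwise form of Hölder's inequality, obtained from the weighted AM-GM inequality. -/
lemma rpow_le_weighted {v p N m α : ℝ} (hm : 0 ≤ m) (hα : α ∈ Ico (m / (m + 1)) 1)
    (hv : 0 ≤ v) (hp : 1 ≤ p) (hN : 0 < N) :
    v ^ α ≤ N ^ α * (p * v / N + p ^ (-m)) := by
  obtain ⟨hα1, hα2⟩ := hα
  have hα0 : 0 ≤ α := le_trans (by positivity) hα1
  have hα' : 0 < 1 - α := by linarith
  have hp0 : 0 < p := by linarith
  have hq : m ≤ α / (1 - α) := by
    rw [div_le_iff₀ (by positivity)] at hα1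
    rw [le_div_iff₀ hα']
    linarith
  have hamgm := Real.geom_mean_le_arith_mean2_weighted hα0 hα'.le
    (show 0 ≤ p * v / N by positivity) (show 0 ≤ p ^ (-(α / (1 - α))) by positivity)
    (by ring)
  have hle : p ^ (-(α / (1 - α))) ≤ p ^ (-m) :=
    Real.rpow_le_rpow_of_exponent_le hp (neg_le_neg hq)
  have heq : (p ^ (-(α / (1 - α)))) ^ (1 - α) = (p ^ α)⁻¹ := by
    rw [← Real.rpow_mul hp0.le, ← Real.rpow_neg hp0.le]
    congr 1
    field_simp
  have hfac : v ^ α = N ^ α * ((p * v / N) ^ α * (p ^ (-(α / (1 - α)))) ^ (1 - α)) := by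
    rw [heq, Real.div_rpow (by positivity) hN.le, Real.mul_rpow hp0.le hv]
    have : 0 < p ^ α := by positivity
    have : 0 < N ^ α := by positivity
    field_simp
  rw [hfac]
  refine mul_le_mul_of_nonneg_left (hamgm.trans (add_le_add ?_ ?_)) (by positivity)
  · exact mul_le_of_le_one_left (by positivity) hα2.le
  · exact (mul_le_of_le_one_left (by positivity) (by linarith)).trans hle

/-- lower bound `V(u) ≥ −C(‖u‖+1)^α` for the Lyapunov function
`V(u) = ∫ η(u) + ∫ Φ u`, where `‖u‖ = ∫ Φ u`; in particular the negative part
of `η(u)` is integrable. -/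
theorem stmt7
    (d : ℕ) (hd : 1 ≤ d)
    (γ γ₁ : ℝ) (hγ : 0 < γ) (hγγ₁ : γ < γ₁)
    (β : ℝ → ℝ) (hβ : ContDiff ℝ 1 β) (hβ0 : β 0 = 0)
    (hβ' : ∀ r : ℝ, γ ≤ deriv β r ∧ deriv β r ≤ γ₁)
    (b : ℝ → ℝ) (hb : ContDiff ℝ 1 b) (hbbd : ∃ M : ℝ, ∀ r : ℝ, |b r| ≤ M)
    (b₀ : ℝ) (hb₀ : 0 < b₀) (hbb₀ : ∀ r : ℝ, 0 ≤ r → b₀ ≤ b r)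
    (m : ℝ) (hm : 2 ≤ m)
    (Φ : Euc d → ℝ) (hΦmeas : Measurable Φ) (hΦ1 : ∀ x, 1 ≤ Φ x)
    (hΦm : Integrable (fun x => Φ x ^ (-m))) :
    ∀ α ∈ Ico (m / (m + 1)) (1:ℝ), ∃ C : ℝ, 0 < C ∧
      ∀ u : Euc d → ℝ, Integrable u → (∀ᵐ x, 0 ≤ u x) →
        Integrable (fun x => Φ x * u x) →
          Integrable (fun x => min (eta β b (u x)) 0)
          ∧ (∫ x, eta β b (u x)) + (∫ x, Φ x * u x)
            ≥ -C * ((∫ x, Φ x * u x) + 1) ^ α := by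
  intro α hα
  have hα0 : 0 < α := lt_of_lt_of_le (by positivity) hα.1
  have hα' : 0 < 1 - α := by linarith [hα.2]
  have hγ₁ : 0 < γ₁ := hγ.trans hγγ₁
  set K : ℝ := γ₁ / b₀ / (1 - α) / α with hK
  have hK0 : 0 < K := by positivity
  have hΦ0 : ∀ x, 0 < Φ x := fun x => one_pos.trans_le (hΦ1 x)
  set J : ℝ := ∫ x, Φ x ^ (-m) with hJ
  have hJ0 : 0 ≤ J := integral_nonneg fun x => Real.rpow_nonneg (hΦ0 x).le _
  refine ⟨K * (1 + J), by positivity, fun u hu hu0 hΦu => ?_⟩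
  have hI0 : 0 ≤ ∫ x, Φ x * u x :=
    integral_nonneg_of_ae (hu0.mono fun x hx => mul_nonneg (hΦ0 x).le hx)
  set I : ℝ := ∫ x, Φ x * u x with hI
  have hN : 0 < I + 1 := by linarith
  set H : Euc d → ℝ := fun x => K * ((I + 1) ^ α * (Φ x * u x / (I + 1) + Φ x ^ (-m))) with hH
  have hHint : Integrable H := (((hΦu.div_const _).add hΦm).const_mul _).const_mul _
  have hH0 : ∀ᵐ x, 0 ≤ H x := by
    filter_upwards [hu0] with x hx
    have := hΦ0 x
    positivity
  have hηH : ∀ᵐ x, -H x ≤ eta β b (u x) := by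
    filter_upwards [hu0] with x hx
    refine le_trans (neg_le_neg ?_) (neg_rpow_le_eta (fun r => hγ.le.trans (hβ' r).1)
      (fun r => (hβ' r).2) hb₀ hbb₀ hα0 hα.2 hx)
    exact mul_le_mul_of_nonneg_left
      (rpow_le_weighted (by linarith) hα hx (hΦ1 x) hN) hK0.le
  have hηmeas : AEStronglyMeasurable (fun x => min (eta β b (u x)) 0) := by
    have hη := (measurable_eta (β := β) hb.continuous.measurable).comp_aemeasurable
      hu.aestronglyMeasurable.aemeasurable
    exact (hη.min aemeasurable_const).aestronglyMeasurable
  refine ⟨hHint.mono' hηmeas ?_, ?_⟩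
  · filter_upwards [hH0, hηH] with x h0 h1
    rw [Real.norm_eq_abs, abs_of_nonpos (min_le_right _ _), neg_le]
    exact le_min h1 (by linarith)
  have hHval : ∫ x, H x ≤ K * (1 + J) * (I + 1) ^ α := by
    have : ∫ x, H x = K * ((I + 1) ^ α * (I / (I + 1) + J)) := by
      rw [hH, integral_const_mul, integral_const_mul,
        integral_add (hΦu.div_const _) hΦm, integral_div]
    rw [this, mul_assoc, mul_comm (1 + J)]
    gcongr
    exact (div_le_one hN).2 (by linarith)
  have hlow : -∫ x, H x ≤ ∫ x, eta β b (u x) := by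
    by_cases hη : Integrable (fun x => eta β b (u x))
    · rw [← integral_neg]
      exact integral_mono_ae hHint.neg hη hηH
    · rw [integral_undef hη]
      exact neg_nonpos.2 (integral_nonneg_of_ae hH0)
  linarith
end
end

section
/- The function g : (0,∞) → ℝ, g(r) = ∫₁^r β′(s)/(s b(s)) ds, is continuous, strictly increasing, and bijective onto ℝ; moreover its inverse g⁻¹ : ℝ → (0,∞) satisfies g⁻¹(s) ≤ e^{(b₀/γ₁) s} for all s ≤ 0 and g⁻¹(s) ≤ e^{(‖b‖_∞/γ) s} for all s ≥ 0. -/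
open MeasureTheory Real Set Filter
open scoped ENNReal NNReal Topology RealInnerProductSpace

noncomputable section

/-- `g(r) = ∫₁^r β′(s)/(s b(s)) ds`. -/
def gfun (β b : ℝ → ℝ) (r : ℝ) : ℝ :=
  ∫ s in (1:ℝ)..r, deriv β s / (s * b s)

lemma hasDerivAt_gfun {β b : ℝ → ℝ} (hβ : Continuous (deriv β)) (hb : Continuous b)
    (hb_pos : ∀ r : ℝ, 0 ≤ r → 0 < b r) {r : ℝ} (hr : 0 < r) :
    HasDerivAt (gfun β b) (deriv β r / (r * b r)) r := by
  have hcont : ContinuousOn (fun s => deriv β s / (s * b s)) (Ioi 0) := by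
    refine hβ.continuousOn.div (continuous_id.mul hb).continuousOn fun s hs => ?_
    exact (mul_pos hs (hb_pos s (le_of_lt hs))).ne'
  refine intervalIntegral.integral_hasDerivAt_right ?_
    (hcont.stronglyMeasurableAtFilter isOpen_Ioi r hr) (hcont.continuousAt (Ioi_mem_nhds hr))
  refine (hcont.mono fun x hx => ?_).intervalIntegrable
  exact (lt_min one_pos hr).trans_le hx.1

/-- A function on `(0,∞)` whose derivative is at least `c / r` grows at least as fast as
`c * log r`. -/
lemma monotoneOn_sub_mul_log {f f' : ℝ → ℝ} {c : ℝ}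
    (hf : ∀ r, 0 < r → HasDerivAt f (f' r) r) (hf' : ∀ r, 0 < r → c / r ≤ f' r) :
    MonotoneOn (fun r => f r - c * Real.log r) (Ioi 0) := by
  have hd : ∀ r, 0 < r → HasDerivAt (fun r => f r - c * Real.log r) (f' r - c * r⁻¹) r :=
    fun r hr => (hf r hr).sub ((Real.hasDerivAt_log hr.ne').const_mul c)
  refine monotoneOn_of_deriv_nonneg (convex_Ioi 0)
    (fun r hr => (hd r hr).continuousAt.continuousWithinAt) ?_ ?_
  · rw [interior_Ioi]
    exact fun r hr => (hd r hr).differentiableAt.differentiableWithinAt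
  · rw [interior_Ioi]
    intro r hr
    rw [(hd r hr).deriv, ← div_eq_mul_inv]
    exact sub_nonneg.2 (hf' r hr)

/-- A continuous function on `(0,∞)` that is at most `c * log r` on `(0,1]` and at least
`c * log r` on `[1,∞)` is onto `ℝ`. -/
lemma image_Ioi_eq_univ_of_log_bounds {f : ℝ → ℝ} {c : ℝ} (hc : 0 < c)
    (hf : ContinuousOn f (Ioi 0)) (hle : ∀ r, 0 < r → r ≤ 1 → f r ≤ c * Real.log r)
    (hge : ∀ r, 1 ≤ r → c * Real.log r ≤ f r) : f '' Ioi 0 = univ := by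
  refine eq_univ_of_forall fun s => ?_
  have hs : 0 ≤ |s| / c := by positivity
  have hlow := hle (Real.exp (-(|s| / c))) (Real.exp_pos _) (Real.exp_le_one_iff.2 (by linarith))
  have hhigh := hge (Real.exp (|s| / c)) (Real.one_le_exp hs)
  rw [Real.log_exp, mul_neg, mul_div_cancel₀ _ hc.ne'] at hlow
  rw [Real.log_exp, mul_div_cancel₀ _ hc.ne'] at hhigh
  have hsub : Icc (Real.exp (-(|s| / c))) (Real.exp (|s| / c)) ⊆ Ioi 0 :=
    fun x hx => (Real.exp_pos _).trans_le hx.1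
  exact image_mono hsub (intermediate_value_Icc (Real.exp_le_exp.2 (by linarith)) (hf.mono hsub)
    ⟨hlow.trans (neg_abs_le s), (le_abs_self s).trans hhigh⟩)

/-- `g` is a continuous strictly increasing bijection from
`(0,∞)` onto `ℝ`, and its inverse satisfies exponential upper bounds. -/
theorem stmt12
    (γ γ₁ : ℝ) (hγ : 0 < γ) (hγγ₁ : γ < γ₁)
    (β : ℝ → ℝ) (hβ : ContDiff ℝ 1 β) (hβ0 : β 0 = 0)
    (hβ' : ∀ r : ℝ, γ ≤ deriv β r ∧ deriv β r ≤ γ₁)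
    (b : ℝ → ℝ) (hb : ContDiff ℝ 1 b) (hbbd : ∃ M : ℝ, ∀ r : ℝ, |b r| ≤ M)
    (b₀ : ℝ) (hb₀ : 0 < b₀) (hbb₀ : ∀ r : ℝ, 0 ≤ r → b₀ ≤ b r) :
    ContinuousOn (gfun β b) (Ioi (0:ℝ))
    ∧ StrictMonoOn (gfun β b) (Ioi (0:ℝ))
    ∧ (gfun β b) '' (Ioi (0:ℝ)) = univ
    ∧ ∃ ginv : ℝ → ℝ,
        (∀ s : ℝ, 0 < ginv s)
        ∧ (∀ s : ℝ, gfun β b (ginv s) = s)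
        ∧ (∀ r : ℝ, 0 < r → ginv (gfun β b r) = r)
        ∧ (∀ s : ℝ, s ≤ 0 → ginv s ≤ Real.exp (b₀ / γ₁ * s))
        ∧ (∀ s : ℝ, 0 ≤ s → ginv s ≤ Real.exp ((⨆ t : ℝ, |b t|) / γ * s)) := by
  set B : ℝ := ⨆ t : ℝ, |b t|
  have hbB : ∀ r, b r ≤ B := fun r => (le_abs_self _).trans <|
    le_ciSup (f := fun t => |b t|) (hbbd.imp fun M hM => by rintro _ ⟨t, rfl⟩; exact hM t) r
  have hb_pos : ∀ r : ℝ, 0 ≤ r → 0 < b r := fun r hr => hb₀.trans_le (hbb₀ r hr)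
  have hB_pos : 0 < B := (hb_pos 0 le_rfl).trans_le (hbB 0)
  have hγ₁ : 0 < γ₁ := hγ.trans hγγ₁
  have hderiv : ∀ r, 0 < r → HasDerivAt (gfun β b) (deriv β r / (r * b r)) r := fun r hr =>
    hasDerivAt_gfun (hβ.continuous_deriv le_rfl) hb.continuous hb_pos hr
  have hlower : MonotoneOn (fun r => gfun β b r - γ / B * Real.log r) (Ioi 0) := by
    refine monotoneOn_sub_mul_log hderiv fun r hr => ?_
    have hbr := hb_pos r hr.le
    rw [div_div, mul_comm B r]
    exact div_le_div₀ (hγ.le.trans (hβ' r).1) (hβ' r).1 (by positivity)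
      (mul_le_mul_of_nonneg_left (hbB r) hr.le)
  have hupper : MonotoneOn (fun r => -gfun β b r - -(γ₁ / b₀) * Real.log r) (Ioi 0) := by
    refine monotoneOn_sub_mul_log (fun r hr => (hderiv r hr).neg) fun r hr => ?_
    rw [neg_div, neg_le_neg_iff, div_div, mul_comm b₀ r]
    exact div_le_div₀ hγ₁.le (hβ' r).2 (by positivity)
      (mul_le_mul_of_nonneg_left (hbb₀ r hr.le) hr.le)
  have hone : gfun β b 1 = 0 := intervalIntegral.integral_same
  have hc : 0 < γ / B := by positivity
  have hcont : ContinuousOn (gfun β b) (Ioi 0) :=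
    fun r hr => (hderiv r hr).continuousAt.continuousWithinAt
  have hmono : StrictMonoOn (gfun β b) (Ioi 0) := by
    intro x hx y hy hxy
    have h := hlower hx hy hxy.le
    have hlog := mul_lt_mul_of_pos_left (Real.log_lt_log hx hxy) hc
    dsimp only at h
    linarith
  have hge : ∀ r, 1 ≤ r → γ / B * Real.log r ≤ gfun β b r := fun r hr => by
    have h := hlower (mem_Ioi.2 one_pos) (mem_Ioi.2 (one_pos.trans_le hr)) hr
    simp only [hone, Real.log_one] at h
    linarith
  have hle : ∀ r, 0 < r → r ≤ 1 → gfun β b r ≤ γ / B * Real.log r := fun r hr hr1 => by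
    have h := hlower (mem_Ioi.2 hr) (mem_Ioi.2 one_pos) hr1
    simp only [hone, Real.log_one] at h
    linarith
  have hge' : ∀ r, 0 < r → r ≤ 1 → γ₁ / b₀ * Real.log r ≤ gfun β b r := fun r hr hr1 => by
    have h := hupper (mem_Ioi.2 hr) (mem_Ioi.2 one_pos) hr1
    simp only [hone, Real.log_one] at h
    linarith
  have hsurj := image_Ioi_eq_univ_of_log_bounds hc hcont hle hge
  refine ⟨hcont, hmono, hsurj, ?_⟩
  choose ginv hpos hinv using fun s : ℝ => hsurj.symm.subset (mem_univ s)
  refine ⟨ginv, hpos, hinv, fun r hr => hmono.injOn (hpos _) hr (hinv _), fun s hs => ?_,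
    fun s hs => ?_⟩
  · have h1 : ginv s ≤ 1 := (hmono.le_iff_le (hpos s) (mem_Ioi.2 one_pos)).1 (by rwa [hinv, hone])
    have h := hge' _ (hpos s) h1
    rw [hinv, div_mul_eq_mul_div, div_le_iff₀ hb₀] at h
    rw [← Real.log_le_iff_le_exp (hpos s), div_mul_eq_mul_div, le_div_iff₀ hγ₁]
    linarith
  · have h1 : 1 ≤ ginv s := (hmono.le_iff_le (mem_Ioi.2 one_pos) (hpos s)).1 (by rwa [hinv, hone])
    have h := hge _ h1
    rw [hinv, div_mul_eq_mul_div, div_le_iff₀ hB_pos] at h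
    rw [← Real.log_le_iff_le_exp (hpos s), div_mul_eq_mul_div, le_div_iff₀ hγ]
    linarith
end
end

section
/- For every μ ∈ ℝ the function x ↦ g⁻¹(μ − Φ(x)) belongs to L¹(ℝ^d), and for every c ∈ (0,∞) there exists a unique μ ∈ ℝ such that ∫_{ℝ^d} g⁻¹(μ − Φ(x)) dx = c. -/
open MeasureTheory Real Set Filter
open scoped ENNReal NNReal Topology RealInnerProductSpace

noncomputable section

/-- Two-sided bound on the increments of a real function, with slopes between `p` and `q`. -/
def IncrementBounds (f : ℝ → ℝ) (p q : ℝ) : Prop :=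
  ∀ s t : ℝ, s ≤ t → p * (t - s) ≤ f t - f s ∧ f t - f s ≤ q * (t - s)

lemma IncrementBounds.continuous {f : ℝ → ℝ} {p q : ℝ} (h : IncrementBounds f p q)
    (hp : 0 < p) (hq : 0 < q) : Continuous f := by
  have key : ∀ s t : ℝ, s ≤ t → dist (f s) (f t) ≤ q * dist s t := by
    intro s t hst
    obtain ⟨h1, h2⟩ := h s t hst
    have h3 : 0 ≤ p * (t - s) := mul_nonneg hp.le (sub_nonneg.2 hst)
    rw [dist_comm, dist_comm s, Real.dist_eq, Real.dist_eq, abs_of_nonneg (h3.trans h1),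
      abs_of_nonneg (sub_nonneg.2 hst)]
    exact h2
  refine (LipschitzWith.of_dist_le_mul (K := ⟨q, hq.le⟩) fun s t => ?_).continuous
  rcases le_total s t with hst | hst
  · exact key s t hst
  · rw [dist_comm, dist_comm s]
    exact key t s hst

lemma IncrementBounds.strictMono {f : ℝ → ℝ} {p q : ℝ} (h : IncrementBounds f p q)
    (hp : 0 < p) : StrictMono f := by
  intro s t hst
  have h1 := (h s t hst.le).1
  have h2 : 0 < p * (t - s) := mul_pos hp (sub_pos.2 hst)
  linarith

lemma IncrementBounds.bijective {f : ℝ → ℝ} {p q : ℝ} (h : IncrementBounds f p q)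
    (hp : 0 < p) (hq : 0 < q) : Function.Bijective f := by
  refine ⟨(h.strictMono hp).injective, (h.continuous hp hq).surjective ?_ ?_⟩
  · refine tendsto_atTop_mono' atTop ?_
      (tendsto_atTop_add_const_left atTop (f 0) (tendsto_id.const_mul_atTop hp))
    filter_upwards [eventually_ge_atTop 0] with t ht
    have := (h 0 t ht).1
    simp only [id, sub_zero] at *
    linarith
  · refine tendsto_atBot_mono' atBot ?_
      (tendsto_atBot_add_const_left atBot (f 0) (tendsto_id.const_mul_atBot hp))
    filter_upwards [eventually_le_atBot 0] with t ht
    have := (h t 0 ht).1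
    simp only [id, zero_sub] at *
    linarith

lemma gfun_sub_bounds {β b : ℝ → ℝ} {γ γ₁ b₀ M : ℝ} (hγ : 0 < γ)
    (hβ : ContDiff ℝ 1 β) (hβ' : ∀ r : ℝ, γ ≤ deriv β r ∧ deriv β r ≤ γ₁)
    (hb : Continuous b) (hbbd : ∀ r : ℝ, |b r| ≤ M)
    (hb₀ : 0 < b₀) (hbb₀ : ∀ r : ℝ, 0 ≤ r → b₀ ≤ b r)
    {r s : ℝ} (hr : 0 < r) (hrs : r ≤ s) :
    γ / M * (log s - log r) ≤ gfun β b s - gfun β b r ∧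
      gfun β b s - gfun β b r ≤ γ₁ / b₀ * (log s - log r) := by
  have hM : 0 < M := hb₀.trans_le ((hbb₀ 0 le_rfl).trans ((le_abs_self _).trans (hbbd 0)))
  have hγ₁ : 0 < γ₁ := hγ.trans_le ((hβ' 0).1.trans (hβ' 0).2)
  have hs : 0 < s := hr.trans_le hrs
  have hpos : ∀ x y : ℝ, 0 < x → 0 < y → ∀ z ∈ uIcc x y, 0 < z := fun x y hx hy z hz =>
    (lt_min hx hy).trans_le hz.1
  have hint : ∀ x y : ℝ, 0 < x → 0 < y →
      IntervalIntegrable (fun z => deriv β z / (z * b z)) volume x y := by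
    intro x y hx hy
    refine ContinuousOn.intervalIntegrable ?_
    refine (hβ.continuous_deriv le_rfl).continuousOn.div
      (continuous_id.mul hb).continuousOn fun z hz => ?_
    have hz0 := hpos x y hx hy z hz
    exact (mul_pos hz0 (hb₀.trans_le (hbb₀ z hz0.le))).ne'
  have hinv : ∀ c : ℝ, IntervalIntegrable (fun z => c * z⁻¹) volume r s := fun c =>
    ContinuousOn.intervalIntegrable <| continuousOn_const.mul <|
      continuousOn_id.inv₀ fun z hz => (hpos r s hr hs z hz).ne'
  have hval : ∀ c : ℝ, ∫ z in r..s, c * z⁻¹ = c * (log s - log r) := by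
    intro c
    rw [intervalIntegral.integral_const_mul, integral_inv_of_pos hr hs,
      log_div hs.ne' hr.ne']
  have hsub : gfun β b s - gfun β b r = ∫ z in r..s, deriv β z / (z * b z) :=
    intervalIntegral.integral_interval_sub_left (hint 1 s one_pos hs) (hint 1 r one_pos hr)
  rw [hsub, ← hval, ← hval]
  constructor
  · refine intervalIntegral.integral_mono_on hrs (hinv _) (hint r s hr hs) fun z hz => ?_
    have hz0 : 0 < z := hr.trans_le hz.1
    have hbz : 0 < b z := hb₀.trans_le (hbb₀ z hz0.le)
    rw [← div_eq_mul_inv, div_div, mul_comm M]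
    exact div_le_div₀ (hγ.le.trans (hβ' z).1) (hβ' z).1 (mul_pos hz0 hbz)
      (mul_le_mul_of_nonneg_left ((le_abs_self _).trans (hbbd z)) hz0.le)
  · refine intervalIntegral.integral_mono_on hrs (hint r s hr hs) (hinv _) fun z hz => ?_
    have hz0 : 0 < z := hr.trans_le hz.1
    rw [← div_eq_mul_inv, div_div, mul_comm b₀]
    exact div_le_div₀ hγ₁.le (hβ' z).2 (mul_pos hz0 hb₀)
      (mul_le_mul_of_nonneg_left (hbb₀ z hz0.le) hz0.le)

lemma incrementBounds_log_inverse {g ginv : ℝ → ℝ} {k K : ℝ} (hk : 0 < k) (hK : 0 < K)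
    (hg : ∀ r s : ℝ, 0 < r → r ≤ s →
      k * (log s - log r) ≤ g s - g r ∧ g s - g r ≤ K * (log s - log r))
    (hpos : ∀ s, 0 < ginv s) (hinv : ∀ s, g (ginv s) = s) :
    IncrementBounds (fun s => log (ginv s)) K⁻¹ k⁻¹ := by
  intro s t hst
  have hle : ginv s ≤ ginv t := by
    by_contra! hlt
    have h1 := (hg _ _ (hpos t) hlt.le).1
    have h2 := mul_pos hk (sub_pos.2 (log_lt_log (hpos t) hlt))
    rw [hinv, hinv] at h1
    linarith
  have h := hg _ _ (hpos s) hle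
  rw [hinv, hinv] at h
  refine ⟨?_, ?_⟩
  · rw [inv_mul_le_iff₀ hK]
    exact h.2
  · rw [le_inv_mul_iff₀ hk]
    exact h.1

/-- Increment bounds for `log ∘ u`, in multiplicative form. -/
lemma IncrementBounds.exp_mul_le {u : ℝ → ℝ} {p q : ℝ}
    (h : IncrementBounds (fun s => log (u s)) p q) (hu : ∀ s, 0 < u s) {s t : ℝ} (hst : s ≤ t) :
    exp (p * (t - s)) * u s ≤ u t ∧ u t ≤ exp (q * (t - s)) * u s := by
  obtain ⟨h1, h2⟩ := h s t hst
  rw [← log_div (hu t).ne' (hu s).ne'] at h1 h2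
  exact ⟨(le_div_iff₀ (hu s)).1 ((le_log_iff_exp_le (div_pos (hu t) (hu s))).1 h1),
    (div_le_iff₀ (hu s)).1 ((log_le_iff_le_exp (div_pos (hu t) (hu s))).1 h2)⟩

lemma IncrementBounds.log_of_exp_mul_le {u : ℝ → ℝ} {p q : ℝ} (hu : ∀ s, 0 < u s)
    (h : ∀ s t : ℝ, s ≤ t →
      exp (p * (t - s)) * u s ≤ u t ∧ u t ≤ exp (q * (t - s)) * u s) :
    IncrementBounds (fun s => log (u s)) p q := by
  intro s t hst
  obtain ⟨h1, h2⟩ := h s t hst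
  rw [← log_div (hu t).ne' (hu s).ne']
  exact ⟨(le_log_iff_exp_le (div_pos (hu t) (hu s))).2 ((le_div_iff₀ (hu s)).2 h1),
    (log_le_iff_le_exp (div_pos (hu t) (hu s))).2 ((div_le_iff₀ (hu s)).2 h2)⟩

lemma exp_neg_mul_le_mul_rpow_neg {p m t : ℝ} (hp : 0 < p) (hm : 0 < m) (ht : 0 < t) :
    exp (-(p * t)) ≤ (m / p) ^ m * t ^ (-m) := by
  have hpm : 0 < p / m := div_pos hp hm
  have h1 : p / m * t ≤ exp (p / m * t) := by linarith [add_one_le_exp (p / m * t)]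
  have h2 : (p / m * t) ^ m ≤ exp (p * t) := by
    refine (rpow_le_rpow (mul_pos hpm ht).le h1 hm.le).trans_eq ?_
    rw [← exp_mul]
    congr 1
    field_simp
  have h3 : (m / p) ^ m * t ^ (-m) = ((p / m * t) ^ m)⁻¹ := by
    rw [mul_rpow hpm.le ht.le, mul_inv, ← inv_rpow hpm.le, inv_div, rpow_neg ht.le]
  rw [h3, exp_neg]
  exact inv_anti₀ (rpow_pos_of_pos (mul_pos hpm ht) m) h2

lemma IncrementBounds.integrable_comp_sub {α : Type*} [MeasurableSpace α] {ν : Measure α}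
    {u : ℝ → ℝ} {p q m : ℝ} (h : IncrementBounds (fun s => log (u s)) p q)
    (hu : ∀ s, 0 < u s) (hp : 0 < p) (hq : 0 < q) (hm : 0 < m) {Φ : α → ℝ}
    (hΦ : Measurable Φ) (hΦ0 : ∀ x, 0 < Φ x) (hΦm : Integrable (fun x => Φ x ^ (-m)) ν) (μ : ℝ) :
    Integrable (fun x => u (μ - Φ x)) ν := by
  have hcont : Continuous u := by
    refine (continuous_exp.comp (h.continuous hp hq)).congr fun s => ?_
    exact exp_log (hu s)
  refine (hΦm.const_mul (u μ * (m / p) ^ m)).mono'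
    (hcont.measurable.comp (measurable_const.sub hΦ)).aestronglyMeasurable
    (Eventually.of_forall fun x => ?_)
  rw [norm_of_nonneg (hu _).le]
  have h1 := (h.exp_mul_le hu (sub_le_self μ (hΦ0 x).le)).1
  rw [sub_sub_cancel] at h1
  calc u (μ - Φ x) = exp (-(p * Φ x)) * (exp (p * Φ x) * u (μ - Φ x)) := by
        rw [← mul_assoc, ← exp_add, neg_add_cancel, exp_zero, one_mul]
    _ ≤ ((m / p) ^ m * Φ x ^ (-m)) * u μ :=
        mul_le_mul (exp_neg_mul_le_mul_rpow_neg hp hm (hΦ0 x)) h1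
          (mul_pos (exp_pos _) (hu _)).le ((exp_pos _).le.trans
            (exp_neg_mul_le_mul_rpow_neg hp hm (hΦ0 x)))
    _ = u μ * (m / p) ^ m * Φ x ^ (-m) := by ring

lemma IncrementBounds.log_integral_comp_sub {α : Type*} [MeasurableSpace α] {ν : Measure α}
    [NeZero ν] {u : ℝ → ℝ} {p q : ℝ} (h : IncrementBounds (fun s => log (u s)) p q)
    (hu : ∀ s, 0 < u s) {Φ : α → ℝ} (hint : ∀ μ, Integrable (fun x => u (μ - Φ x)) ν) :
    (∀ μ, 0 < ∫ x, u (μ - Φ x) ∂ν) ∧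
      IncrementBounds (fun μ => log (∫ x, u (μ - Φ x) ∂ν)) p q := by
  have hpos : ∀ μ, 0 < ∫ x, u (μ - Φ x) ∂ν := by
    intro μ
    rw [integral_pos_iff_support_of_nonneg (fun x => (hu _).le) (hint μ),
      Function.support_eq_univ fun x => (hu _).ne']
    exact Measure.measure_univ_pos.2 (NeZero.ne ν)
  refine ⟨hpos, IncrementBounds.log_of_exp_mul_le hpos fun s t hst => ?_⟩
  have hx := fun x => h.exp_mul_le hu (sub_le_sub_right hst (Φ x))
  simp only [sub_sub_sub_cancel_right] at hx
  rw [← integral_const_mul, ← integral_const_mul]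
  exact ⟨integral_mono ((hint s).const_mul _) (hint t) fun x => (hx x).1,
    integral_mono (hint t) ((hint s).const_mul _) fun x => (hx x).2⟩

/-- the function `x ↦ g⁻¹(μ − Φ(x))` is integrable for every
`μ`, and for every prescribed total mass `c > 0` there is exactly one `μ`
realizing it. -/
theorem stmt14
    (d : ℕ) (hd : 1 ≤ d)
    (γ γ₁ : ℝ) (hγ : 0 < γ) (hγγ₁ : γ < γ₁)
    (β : ℝ → ℝ) (hβ : ContDiff ℝ 1 β) (hβ0 : β 0 = 0)
    (hβ' : ∀ r : ℝ, γ ≤ deriv β r ∧ deriv β r ≤ γ₁)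
    (b : ℝ → ℝ) (hb : ContDiff ℝ 1 b) (hbbd : ∃ M : ℝ, ∀ r : ℝ, |b r| ≤ M)
    (b₀ : ℝ) (hb₀ : 0 < b₀) (hbb₀ : ∀ r : ℝ, 0 ≤ r → b₀ ≤ b r)
    (ginv : ℝ → ℝ) (hginv0 : ∀ s : ℝ, 0 < ginv s)
    (hginv1 : ∀ s : ℝ, gfun β b (ginv s) = s)
    (hginv2 : ∀ r : ℝ, 0 < r → ginv (gfun β b r) = r)
    (m : ℝ) (hm : 2 ≤ m)
    (Φ : Euc d → ℝ) (hΦmeas : Measurable Φ) (hΦ1 : ∀ x, 1 ≤ Φ x)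
    (hΦm : Integrable (fun x => Φ x ^ (-m))) :
    (∀ μ : ℝ, Integrable (fun x => ginv (μ - Φ x)))
    ∧ ∀ c : ℝ, 0 < c → ∃! μ : ℝ, ∫ x, ginv (μ - Φ x) = c := by
  obtain ⟨M, hM⟩ := hbbd
  have hM0 : 0 < M := hb₀.trans_le ((hbb₀ 0 le_rfl).trans ((le_abs_self _).trans (hM 0)))
  have hk : 0 < γ / M := div_pos hγ hM0
  have hK : 0 < γ₁ / b₀ := div_pos (hγ.trans hγγ₁) hb₀
  have hlog := incrementBounds_log_inverse hk hK
    (fun r s hr hrs => gfun_sub_bounds hγ hβ hβ' hb.continuous hM hb₀ hbb₀ hr hrs)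
    hginv0 hginv1
  have hint := hlog.integrable_comp_sub hginv0 (inv_pos.2 hK) (inv_pos.2 hk)
    (two_pos.trans_le hm) hΦmeas (fun x => one_pos.trans_le (hΦ1 x)) hΦm
  refine ⟨hint, fun c hc => ?_⟩
  obtain ⟨hF, hFlog⟩ := hlog.log_integral_comp_sub hginv0 hint
  obtain ⟨μ, hμ, huniq⟩ :=
    (hFlog.bijective (inv_pos.2 hK) (inv_pos.2 hk)).existsUnique (log c)
  refine ⟨μ, log_injOn_pos (hF μ) hc hμ, fun ν hν => huniq ν ?_⟩
  exact congrArg log hν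
end
end

section
/- For every r ≥ δ the bracketed expression in the definition of h is strictly positive (so h is well defined and h(r) < 0), h is differentiable on (δ,∞), it satisfies the Riccati equation h′(r) + ((d−1)/r) h(r) − α h(r)² = 0 for all r ∈ (δ,∞), and h(δ) = δ(2 log δ + 1) − η = −(2δ/d + η). -/
open Real Set Filter

noncomputable section

/-- `δ = exp(−(d+2)/(2d))`. -/
def deltaOf (d : ℕ) : ℝ := Real.exp (-((d : ℝ) + 2) / (2 * d))

/-- The bracketed expression in the explicit formula for `h`. -/
def Bfun (d : ℕ) (α η : ℝ) (r : ℝ) : ℝ :=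
  if d = 2 then
    (deltaOf d)⁻¹ * (deltaOf d + η)⁻¹ + α * Real.log (r / deltaOf d)
  else
    ((deltaOf d)⁻¹ * (2 * deltaOf d / d + η)⁻¹ + α / ((d : ℝ) - 2))
        * (r / deltaOf d) ^ ((d : ℝ) - 2)
      - α / ((d : ℝ) - 2)

/-- The explicit solution `h` of the Riccati equation (A.1)–(A.2). -/
def hfun (d : ℕ) (α η : ℝ) (r : ℝ) : ℝ := -r⁻¹ * (Bfun d α η r)⁻¹

lemma deltaOf_pos (d : ℕ) : 0 < deltaOf d := Real.exp_pos _

lemma two_mul_log_deltaOf_add_one {d : ℕ} (hd : d ≠ 0) :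
    2 * Real.log (deltaOf d) + 1 = -(2 / d) := by
  have : (d : ℝ) ≠ 0 := Nat.cast_ne_zero.mpr hd
  rw [deltaOf, Real.log_exp]
  field_simp
  ring

lemma rpow_sub_one_div_nonneg {t : ℝ} (ht : 1 ≤ t) (p : ℝ) : 0 ≤ (t ^ p - 1) / p := by
  rcases le_total 0 p with hp | hp
  · exact div_nonneg (sub_nonneg.mpr (Real.one_le_rpow ht hp)) hp
  · exact div_nonneg_of_nonpos
      (sub_nonpos.mpr (Real.rpow_le_one_of_one_le_of_nonpos ht hp)) hp

lemma Bfun_deltaOf (d : ℕ) (α η : ℝ) :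
    Bfun d α η (deltaOf d) = (deltaOf d)⁻¹ * (2 * deltaOf d / d + η)⁻¹ := by
  have hδ := (deltaOf_pos d).ne'
  unfold Bfun
  split_ifs with h
  · subst h
    simp [div_self hδ]
  · simp [div_self hδ]

lemma Bfun_pos (d : ℕ) {α η r : ℝ} (hα : 0 ≤ α) (hη : 0 < η) (hr : deltaOf d ≤ r) :
    0 < Bfun d α η r := by
  have hδ := deltaOf_pos d
  have ht : 1 ≤ r / deltaOf d := (one_le_div hδ).mpr hr
  unfold Bfun
  split_ifs with h
  · have := Real.log_nonneg ht
    positivity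
  · have hq := mul_nonneg hα (rpow_sub_one_div_nonneg ht ((d : ℝ) - 2))
    have ha : 0 < (deltaOf d)⁻¹ * (2 * deltaOf d / d + η)⁻¹
        * (r / deltaOf d) ^ ((d : ℝ) - 2) := by
      have : 0 < r / deltaOf d := one_pos.trans_le ht
      positivity
    calc 0 < _ := add_pos_of_pos_of_nonneg ha hq
      _ = _ := by ring

lemma hasDerivAt_Bfun (d : ℕ) (α η : ℝ) {r : ℝ} (hr : 0 < r) :
    HasDerivAt (Bfun d α η) ((α + ((d : ℝ) - 2) * Bfun d α η r) / r) r := by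
  have hδ := deltaOf_pos d
  have ht : 0 < r / deltaOf d := div_pos hr hδ
  have hdiv : HasDerivAt (fun x => x / deltaOf d) (1 / deltaOf d) r :=
    (hasDerivAt_id r).div_const _
  by_cases h : d = 2
  · have hB : Bfun d α η = fun x =>
        (deltaOf d)⁻¹ * (deltaOf d + η)⁻¹ + α * Real.log (x / deltaOf d) := by
      funext x
      simp only [Bfun, if_pos h]
    have hd2 : (d : ℝ) - 2 = 0 := by simp [h]
    rw [hB, hd2]
    refine (((hdiv.log ht.ne').const_mul α).const_add _).congr_deriv ?_
    field_simp
    ring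
  · have hB : Bfun d α η = fun x =>
        ((deltaOf d)⁻¹ * (2 * deltaOf d / d + η)⁻¹ + α / ((d : ℝ) - 2))
          * (x / deltaOf d) ^ ((d : ℝ) - 2) - α / ((d : ℝ) - 2) := by
      funext x
      simp only [Bfun, if_neg h]
    have hp : (d : ℝ) - 2 ≠ 0 := sub_ne_zero.mpr (by exact_mod_cast h)
    rw [hB]
    refine (((hdiv.rpow_const (Or.inl ht.ne')).const_mul _).sub_const _).congr_deriv ?_
    dsimp only
    rw [Real.rpow_sub_one ht.ne']
    generalize (r / deltaOf d) ^ ((d : ℝ) - 2) = y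
    generalize (2 * deltaOf d / d + η)⁻¹ = c
    generalize (d : ℝ) - 2 = p at *
    field_simp
    ring

lemma hasDerivAt_hfun (d : ℕ) (α η : ℝ) {r : ℝ} (hr : 0 < r) (hB : Bfun d α η r ≠ 0) :
    HasDerivAt (hfun d α η)
      (α * (hfun d α η r) ^ 2 - ((d : ℝ) - 1) / r * hfun d α η r) r := by
  refine ((hasDerivAt_inv hr.ne').neg.mul ((hasDerivAt_Bfun d α η hr).inv hB)).congr_deriv ?_
  simp only [hfun, Pi.neg_apply, Pi.inv_apply]
  field_simp
  ring

lemma hfun_deltaOf (d : ℕ) (α η : ℝ) :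
    hfun d α η (deltaOf d) = -(2 * deltaOf d / d + η) := by
  have hδ := (deltaOf_pos d).ne'
  rw [hfun, Bfun_deltaOf, mul_inv, inv_inv, inv_inv, neg_mul, inv_mul_cancel_left₀ hδ]

/-- the bracket is strictly positive on `[δ,∞)` (so `h` is well
defined and negative there), `h` is differentiable on `(δ,∞)` and solves the
Riccati equation `h′ + ((d−1)/r) h − α h² = 0`, with the stated value at `δ`. -/
theorem stmt18
    (d : ℕ) (hd : 1 ≤ d) (α η : ℝ) (hα : 0 < α) (hη : 0 < η) :
    (∀ r : ℝ, deltaOf d ≤ r → 0 < Bfun d α η r)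
    ∧ (∀ r : ℝ, deltaOf d ≤ r → hfun d α η r < 0)
    ∧ (∀ r ∈ Ioi (deltaOf d),
        HasDerivAt (hfun d α η)
          (α * (hfun d α η r) ^ 2 - ((d : ℝ) - 1) / r * hfun d α η r) r)
    ∧ hfun d α η (deltaOf d) = deltaOf d * (2 * Real.log (deltaOf d) + 1) - η
    ∧ hfun d α η (deltaOf d) = -(2 * deltaOf d / d + η) := by
  have hB : ∀ r : ℝ, deltaOf d ≤ r → 0 < Bfun d α η r := fun r hr => Bfun_pos d hα.le hη hr
  refine ⟨hB, fun r hr => ?_, fun r hr => ?_, ?_, hfun_deltaOf d α η⟩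
  · have hr0 : 0 < r := (deltaOf_pos d).trans_le hr
    exact mul_neg_of_neg_of_pos (neg_lt_zero.mpr (inv_pos.mpr hr0)) (inv_pos.mpr (hB r hr))
  · exact hasDerivAt_hfun d α η ((deltaOf_pos d).trans hr) (hB r (le_of_lt hr)).ne'
  · rw [hfun_deltaOf, two_mul_log_deltaOf_add_one (Nat.one_le_iff_ne_zero.mp hd)]
    ring
end
end
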